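/- Let d, Γ ≥ 1 and a ≥ 1 be integers, let P ⊆ ℝ^d, let 𝓘 be a set, and let h : 𝓘 × P → ℤ. Suppose that for every I ∈ 𝓘 there exist real polynomials p_1^I, …, p_Γ^I on ℝ^d of degree at most a and real polynomials q_1^I, …, q_Γ^I on ℝ^d with q_i^I(μ) > 0 for all μ ∈ P, such that h(I, μ) = h(I, μ') whenever μ, μ' ∈ P satisfy sgn(p_i^I(μ)/q_i^I(μ)) = sgn(p_i^I(μ')/q_i^I(μ')) for all i = 1,…,Γ. Then for every integer t ≥ d, every I_1, …, I_t ∈ 𝓘, and every s_1, …, s_t ∈ ℝ, the number of distinct sign-pattern vectors |{ ( sgn(h(I_1, μ) − s_1), …, sgn(h(I_t, μ) − s_t) ) : μ ∈ P }| is at most 2(2eΓta/d)^d, where e is the base of the natural logarithm. -/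

import Mathlib

/-- The sign function `sgn : ℝ → {0,1}`: `sgn x = 1` if `x ≥ 0`, else `0`. -/
noncomputable def sgn01 (x : ℝ) : ℕ := if 0 ≤ x then 1 else 0

section Warren
set_option linter.unusedSectionVars false
open MvPolynomial

variable {I J : Type} [Fintype I] [Fintype J]

/-- polynomials of bidegree at most `(n1, n2)` -/
noncomputable def Vd (I J : Type) [Fintype I] [Fintype J] (n1 n2 : ℕ) :
    Submodule ℝ (MvPolynomial (I ⊕ J) ℝ) :=
  restrictSupport ℝ {e | (∑ i, e (Sum.inl i)) ≤ n1 ∧ (∑ j, e (Sum.inr j)) ≤ n2}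

lemma Vd_mul {n1 n2 k1 k2 l1 l2 : ℕ} {f g : MvPolynomial (I ⊕ J) ℝ}
    (hf : f ∈ Vd I J n1 n2) (hg : g ∈ Vd I J k1 k2) (h1 : n1 + k1 ≤ l1) (h2 : n2 + k2 ≤ l2) :
    f * g ∈ Vd I J l1 l2 := by
  classical
  unfold Vd at *
  rw [mem_restrictSupport_iff] at *
  intro e he
  have := support_mul f g he
  rw [Finset.mem_add] at this
  obtain ⟨x, hx, y, hy, rfl⟩ := this
  have hx' := hf hx
  have hy' := hg hy
  simp only [Set.mem_ofPred_eq, Finsupp.add_apply, Finset.sum_add_distrib] at *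
  omega

lemma Vd_mono {n1 n2 l1 l2 : ℕ} (h1 : n1 ≤ l1) (h2 : n2 ≤ l2) : Vd I J n1 n2 ≤ Vd I J l1 l2 := by
  apply restrictSupport_mono
  intro e he
  simp only [Set.mem_ofPred_eq] at *
  omega

lemma monomial_mem_Vd {n1 n2 : ℕ} (e : (I ⊕ J) →₀ ℕ) (c : ℝ)
    (h1 : (∑ i, e (Sum.inl i)) ≤ n1) (h2 : (∑ j, e (Sum.inr j)) ≤ n2) :
    monomial e c ∈ Vd I J n1 n2 := by
  unfold Vd
  rw [monomial_mem_restrictSupport]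
  left; exact ⟨h1, h2⟩

lemma Vd_C {n1 n2 : ℕ} (c : ℝ) : (C c : MvPolynomial (I ⊕ J) ℝ) ∈ Vd I J n1 n2 :=
  monomial_mem_Vd 0 c (by simp) (by simp)

lemma Vd_one {n1 n2 : ℕ} : (1 : MvPolynomial (I ⊕ J) ℝ) ∈ Vd I J n1 n2 := Vd_C 1

lemma Vd_inl (i : I) : (X (Sum.inl i) : MvPolynomial (I ⊕ J) ℝ) ∈ Vd I J 1 0 := by
  classical
  apply monomial_mem_Vd <;> simp [Finsupp.single_apply]

lemma Vd_inr (j : J) : (X (Sum.inr j) : MvPolynomial (I ⊕ J) ℝ) ∈ Vd I J 0 1 := by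
  classical
  apply monomial_mem_Vd <;> simp [Finsupp.single_apply]

lemma Vd_inr_pow (j : J) (n : ℕ) : (X (Sum.inr j) ^ n : MvPolynomial (I ⊕ J) ℝ) ∈ Vd I J 0 n := by
  classical
  rw [X_pow_eq_monomial]
  apply monomial_mem_Vd <;> simp [Finsupp.single_apply]

lemma Vd_le_of_monomial {n1 n2 : ℕ} (W : Submodule ℝ (MvPolynomial (I ⊕ J) ℝ))
    (h : ∀ e : (I ⊕ J) →₀ ℕ, (∑ i, e (Sum.inl i)) ≤ n1 → (∑ j, e (Sum.inr j)) ≤ n2 →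
      monomial e (1:ℝ) ∈ W) : Vd I J n1 n2 ≤ W := by
  unfold Vd
  rw [restrictSupport_eq_span, Submodule.span_le]
  rintro _ ⟨e, he, rfl⟩
  exact h e he.1 he.2

instance Vd_fin (n1 n2 : ℕ) : FiniteDimensional ℝ (Vd I J n1 n2) := by
  classical
  have hf : {e : (I ⊕ J) →₀ ℕ | (∑ i, e (Sum.inl i)) ≤ n1 ∧ (∑ j, e (Sum.inr j)) ≤ n2}.Finite := by
    refine (Finset.finite_toSet (Finset.Iic (Finsupp.equivFunOnFinite.symm fun _ : I ⊕ J => n1 + n2))).subset ?_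
    intro e he
    simp only [Finset.coe_Iic, Set.mem_Iic]
    intro x
    simp only [Finsupp.equivFunOnFinite_symm_apply_apply]
    rcases x with i | j
    · have := Finset.single_le_sum (f := fun i => e (Sum.inl i)) (fun _ _ => Nat.zero_le _) (Finset.mem_univ i)
      exact (this.trans he.1).trans (by omega)
    · have := Finset.single_le_sum (f := fun i => e (Sum.inr i)) (fun _ _ => Nat.zero_le _) (Finset.mem_univ j)
      exact (this.trans he.2).trans (by omega)
  have := hf.to_subtype
  exact Module.Finite.of_basis (basisRestrictSupport ℝ {e : (I ⊕ J) →₀ ℕ | (∑ i, e (Sum.inl i)) ≤ n1 ∧ (∑ j, e (Sum.inr j)) ≤ n2})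

/-- split off one variable power from a monomial -/
lemma monomial_split (e : (I ⊕ J) →₀ ℕ) (x : I ⊕ J) (n : ℕ) (h : n ≤ e x) :
    monomial e (1:ℝ) = X x ^ n * monomial (e - Finsupp.single x n) 1 := by
  rw [X_pow_eq_monomial, monomial_mul]
  have : Finsupp.single x n ≤ e := by simpa using h
  rw [add_tsub_cancel_of_le this]; simp

lemma sum_inl_sub (e : (I ⊕ J) →₀ ℕ) (i : I) (n : ℕ) (h : n ≤ e (Sum.inl i)) :
    (∑ k, (e - Finsupp.single (Sum.inl i) n : (I ⊕ J) →₀ ℕ) (Sum.inl k)) + n = ∑ k, e (Sum.inl k) := by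
  classical
  have h' : Finsupp.single (Sum.inl i) n ≤ e := by simpa using h
  have : e = (e - Finsupp.single (Sum.inl i) n) + Finsupp.single (Sum.inl i) n :=
    (tsub_add_cancel_of_le h').symm
  conv_rhs => rw [this]
  rw [Finset.sum_congr rfl (fun k _ => Finsupp.add_apply _ _ _), Finset.sum_add_distrib]
  simp [Finsupp.single_apply]

lemma sum_inr_sub (e : (I ⊕ J) →₀ ℕ) (i : J) (n : ℕ) (h : n ≤ e (Sum.inr i)) :
    (∑ k, (e - Finsupp.single (Sum.inr i) n : (I ⊕ J) →₀ ℕ) (Sum.inr k)) + n = ∑ k, e (Sum.inr k) := by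
  classical
  have h' : Finsupp.single (Sum.inr i) n ≤ e := by simpa using h
  have : e = (e - Finsupp.single (Sum.inr i) n) + Finsupp.single (Sum.inr i) n :=
    (tsub_add_cancel_of_le h').symm
  conv_rhs => rw [this]
  rw [Finset.sum_congr rfl (fun k _ => Finsupp.add_apply _ _ _), Finset.sum_add_distrib]
  simp [Finsupp.single_apply]

lemma sum_inr_sub_inl (e : (I ⊕ J) →₀ ℕ) (i : I) (n : ℕ) :
    (∑ k, (e - Finsupp.single (Sum.inl i) n : (I ⊕ J) →₀ ℕ) (Sum.inr k)) = ∑ k, e (Sum.inr k) := by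
  simp

lemma sum_inl_sub_inr (e : (I ⊕ J) →₀ ℕ) (i : J) (n : ℕ) :
    (∑ k, (e - Finsupp.single (Sum.inr i) n : (I ⊕ J) →₀ ℕ) (Sum.inl k)) = ∑ k, e (Sum.inl k) := by
  simp

lemma leaf_big (a n1 n2 : ℕ) (ha : 1 ≤ a) (hn2 : Fintype.card J * a ≤ n2)
    (W : Submodule ℝ (MvPolynomial (I ⊕ J) ℝ))
    (h1 : ∀ v ∈ Vd I J n1 n2, v ∈ W)
    (hX : ∀ j, ∀ v ∈ Vd I J n1 n2, X (Sum.inr j) ^ a * v ∈ W) :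
    Vd I J n1 (n2 + a) ≤ W := by
  apply Vd_le_of_monomial
  intro e he1 he2
  by_cases hs : (∑ j, e (Sum.inr j)) ≤ n2
  · exact h1 _ (monomial_mem_Vd e 1 he1 hs)
  · have : ∃ j, a ≤ e (Sum.inr j) := by
      by_contra hcon
      push Not at hcon
      apply hs
      calc (∑ j, e (Sum.inr j)) ≤ ∑ _j : J, a := Finset.sum_le_sum (fun j _ => (hcon j).le)
        _ = Fintype.card J * a := by simp
        _ ≤ n2 := hn2
    obtain ⟨j, hj⟩ := this
    rw [monomial_split e (Sum.inr j) a hj]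
    apply hX
    apply monomial_mem_Vd
    · rw [sum_inl_sub_inr]; exact he1
    · have := sum_inr_sub e j a hj
      omega

lemma leaf_small (n1 n2 : ℕ) 
    (W : Submodule ℝ (MvPolynomial (I ⊕ J) ℝ))
    (h1 : ∀ v ∈ Vd I J n1 n2, v ∈ W)
    (hX : ∀ i, ∀ v ∈ Vd I J n1 n2, X (Sum.inl i) * v ∈ W) :
    Vd I J (n1 + 1) n2 ≤ W := by
  apply Vd_le_of_monomial
  intro e he1 he2
  by_cases hs : (∑ j, e (Sum.inl j)) ≤ n1
  · exact h1 _ (monomial_mem_Vd e 1 hs he2)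
  · have : ∃ i, 1 ≤ e (Sum.inl i) := by
      by_contra hcon
      push Not at hcon
      apply hs
      rw [Finset.sum_eq_zero (fun i _ => by have := hcon i; omega)]
      omega
    obtain ⟨j, hj⟩ := this
    rw [monomial_split e (Sum.inl j) 1 hj, pow_one]
    apply hX
    apply monomial_mem_Vd
    · have := sum_inl_sub e j 1 hj
      omega
    · rw [sum_inr_sub_inl]; exact he2

/-- the monomials in `x` with all exponents `< a` -/
noncomputable def boxB (I J : Type) [Fintype I] [Fintype J] [DecidableEq J] (a : ℕ) :
    Set (MvPolynomial (I ⊕ J) ℝ) :=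
  Set.range (fun f : J → Fin a => ∏ j, (X (Sum.inr j) : MvPolynomial (I ⊕ J) ℝ) ^ (f j : ℕ))

lemma leaf_eq [DecidableEq J] (a n1 n2 : ℕ) (ha : 1 ≤ a)
    (W : Submodule ℝ (MvPolynomial (I ⊕ J) ℝ))
    (hA : ∀ i, ∃ c : ℝ, ∀ v ∈ Vd I J n1 (n2 + a), (X (Sum.inl i) - C c) * v ∈ W)
    (hX : ∀ j, ∃ c : ℝ, ∀ v ∈ Vd I J (n1 + 1) n2, (X (Sum.inr j) ^ a - C c) * v ∈ W) :
    Vd I J (n1 + 1) (n2 + a) ≤ W ⊔ Submodule.span ℝ (boxB I J a) := by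
  apply Vd_le_of_monomial
  intro e
  induction hN : (∑ i, e (Sum.inl i)) + (∑ j, e (Sum.inr j)) using Nat.strong_induction_on generalizing e with
  | _ N ih =>
  intro he1 he2
  by_cases hi : ∃ i, 1 ≤ e (Sum.inl i)
  · obtain ⟨i, hi⟩ := hi
    obtain ⟨c, hc⟩ := hA i
    have e1 := sum_inl_sub e i 1 hi
    have e2 := sum_inr_sub_inl e i 1
    have hv := hc (monomial (e - Finsupp.single (Sum.inl i) 1) 1)
      (monomial_mem_Vd _ _ (by omega) (by omega))
    have hr := ih _ (by omega) (e - Finsupp.single (Sum.inl i) 1) rfl (by omega) (by omega)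
    rw [monomial_split e (Sum.inl i) 1 hi, pow_one]
    have : X (Sum.inl i) * monomial (e - Finsupp.single (Sum.inl i) 1) (1:ℝ) =
      (X (Sum.inl i) - C c) * monomial (e - Finsupp.single (Sum.inl i) 1) (1:ℝ) +
      c • monomial (e - Finsupp.single (Sum.inl i) 1) (1:ℝ) := by
      rw [smul_eq_C_mul]; ring
    rw [this]
    exact add_mem (Submodule.mem_sup_left hv) (Submodule.smul_mem _ _ hr)
  by_cases hj : ∃ j, a ≤ e (Sum.inr j)
  · obtain ⟨j, hj⟩ := hj
    obtain ⟨c, hc⟩ := hX j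
    have e1 := sum_inr_sub e j a hj
    have e2 := sum_inl_sub_inr e j a
    have hv := hc (monomial (e - Finsupp.single (Sum.inr j) a) 1)
      (monomial_mem_Vd _ _ (by omega) (by omega))
    have hr := ih _ (by omega) (e - Finsupp.single (Sum.inr j) a) rfl (by omega) (by omega)
    rw [monomial_split e (Sum.inr j) a hj]
    have : X (Sum.inr j) ^ a * monomial (e - Finsupp.single (Sum.inr j) a) (1:ℝ) =
      (X (Sum.inr j) ^ a - C c) * monomial (e - Finsupp.single (Sum.inr j) a) (1:ℝ) +
      c • monomial (e - Finsupp.single (Sum.inr j) a) (1:ℝ) := by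
      rw [smul_eq_C_mul]; ring
    rw [this]
    exact add_mem (Submodule.mem_sup_left hv) (Submodule.smul_mem _ _ hr)
  push Not at hi hj
  apply Submodule.mem_sup_right
  apply Submodule.subset_span
  refine ⟨fun j => ⟨e (Sum.inr j), hj j⟩, ?_⟩
  simp only
  rw [monomial_eq, Finsupp.prod_fintype _ _ (by simp), Fintype.prod_sum_type]
  have : ∀ i, e (Sum.inl i) = 0 := fun i => by have := hi i; omega
  simp [this]

/-- leaf counting function -/
def Nct (d L : ℕ) : ℕ → ℕ → ℕ
  | 0, e => if e = d then L else 0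
  | k + 1, e => Nct d L k (e + 1) + Nct d L k e

lemma Nct_eq (d L k e : ℕ) : Nct d L k e = if e ≤ d then k.choose (d - e) * L else 0 := by
  induction k generalizing e with
  | zero =>
    unfold Nct
    rcases lt_trichotomy e d with h | h | h
    · rw [if_neg h.ne, if_pos h.le, Nat.choose_eq_zero_of_lt (by omega)]; simp
    · subst h; simp
    · rw [if_neg h.ne', if_neg (by omega)]
  | succ k ih =>
    unfold Nct
    rw [ih, ih]
    rcases lt_trichotomy e d with h | h | h
    · obtain ⟨r, rfl⟩ := Nat.exists_eq_add_of_lt h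
      rw [if_pos (by omega), if_pos (by omega), if_pos (by omega)]
      have h1 : e + r + 1 - (e + 1) = r := by omega
      have h2 : e + r + 1 - e = r + 1 := by omega
      rw [h1, h2, Nat.choose_succ_succ]; ring
    · subst h; simp
    · rw [if_neg (by omega), if_neg (by omega), if_neg (by omega)]

lemma mul_mem_of_span {s : Set (MvPolynomial (I ⊕ J) ℝ)} {W V : Submodule ℝ (MvPolynomial (I ⊕ J) ℝ)}
    (h : ∀ f ∈ s, ∀ v ∈ V, f * v ∈ W) : ∀ f ∈ Submodule.span ℝ s, ∀ v ∈ V, f * v ∈ W := by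
  intro f hf v hv
  induction hf using Submodule.span_induction with
  | mem x hx => exact h x hx v hv
  | zero => simp
  | add x y _ _ hx hy => rw [add_mul]; exact add_mem hx hy
  | smul c x _ hx => rw [smul_mul_assoc]; exact W.smul_mem c hx

lemma splitting [DecidableEq I] [DecidableEq J] (a n2 : ℕ) (ha : 1 ≤ a)
    (hn2 : Fintype.card J * a ≤ n2)
    (A B : I ⊕ J → MvPolynomial (I ⊕ J) ℝ)
    (hAV : ∀ κ, A κ ∈ Vd I J 1 0)
    (hB1 : ∀ S : Finset (I ⊕ J), Fintype.card J + 1 ≤ S.card →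
      1 ∈ Submodule.span ℝ (B '' S) ∧ ∀ j, X (Sum.inr j) ^ a ∈ Submodule.span ℝ (B '' S))
    (hA1 : ∀ S : Finset (I ⊕ J), Fintype.card I + 1 ≤ S.card →
      1 ∈ Submodule.span ℝ (A '' S) ∧ ∀ i, X (Sum.inl i) ∈ Submodule.span ℝ (A '' S))
    (hB2 : ∀ S : Finset (I ⊕ J), S.card = Fintype.card J →
      ∀ j, ∃ c : ℝ, X (Sum.inr j) ^ a - C c ∈ Submodule.span ℝ (B '' S))
    (hA2 : ∀ S : Finset (I ⊕ J), S.card = Fintype.card I →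
      ∀ i, ∃ c : ℝ, X (Sum.inl i) - C c ∈ Submodule.span ℝ (A '' S)) :
    ∀ (K S S' : Finset (I ⊕ J)) (_ : K.card + S.card + S'.card = Fintype.card I + Fintype.card J)
      (n1 : ℕ) (_ : K.card ≤ n1) (W : Submodule ℝ (MvPolynomial (I ⊕ J) ℝ))
      (_ : ∀ κ ∈ K, ∀ v ∈ Vd I J n1 n2, A κ * B κ * v ∈ W)
      (_ : ∀ κ ∈ S, ∀ v ∈ Vd I J (n1 + 1) n2, B κ * v ∈ W)
      (_ : ∀ κ ∈ S', ∀ v ∈ Vd I J n1 (n2 + a), A κ * v ∈ W),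
      Disjoint K S → Disjoint K S' → Disjoint S S' →
      ∃ T : Finset (MvPolynomial (I ⊕ J) ℝ),
        T.card ≤ Nct (Fintype.card J) (a ^ Fintype.card J) K.card S.card ∧
        Vd I J (n1 + 1) (n2 + a) ≤ W ⊔ Submodule.span ℝ (T : Set (MvPolynomial (I ⊕ J) ℝ)) := by
  intro K
  induction K using Finset.induction_on with
  | empty =>
    intro S S' hcard n1 _ W _ hS hS' _ _ _
    rw [Finset.card_empty, zero_add] at hcard
    have gS := mul_mem_of_span (s := B '' S) (W := W) (V := Vd I J (n1 + 1) n2)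
      (by rintro _ ⟨κ, hκ, rfl⟩; exact hS κ hκ)
    have gS' := mul_mem_of_span (s := A '' S') (W := W) (V := Vd I J n1 (n2 + a))
      (by rintro _ ⟨κ, hκ, rfl⟩; exact hS' κ hκ)
    rcases lt_trichotomy S.card (Fintype.card J) with h | h | h
    · obtain ⟨h1, h2⟩ := hA1 S' (by omega)
      refine ⟨∅, by simp, ?_⟩
      refine le_trans ?_ le_sup_left
      apply leaf_small
      · intro v hv; simpa using gS' 1 h1 v hv
      · intro i v hv; exact gS' _ (h2 i) v hv
    · refine ⟨Finset.univ.image (fun f : J → Fin a => ∏ j, (X (Sum.inr j) : MvPolynomial (I ⊕ J) ℝ) ^ (f j : ℕ)), ?_, ?_⟩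
      · refine Finset.card_image_le.trans ?_
        simp [Nct, h]
      · have : ((Finset.univ.image (fun f : J → Fin a => ∏ j, (X (Sum.inr j) : MvPolynomial (I ⊕ J) ℝ) ^ (f j : ℕ)) : Finset _) : Set (MvPolynomial (I ⊕ J) ℝ)) = boxB I J a := by
          simp [boxB]
        rw [this]
        apply leaf_eq a n1 n2 ha
        · intro i
          obtain ⟨c, hc⟩ := hA2 S' (by omega) i
          exact ⟨c, gS' _ hc⟩
        · intro j
          obtain ⟨c, hc⟩ := hB2 S h j
          exact ⟨c, gS _ hc⟩
    · obtain ⟨h1, h2⟩ := hB1 S (by omega)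
      refine ⟨∅, by simp, ?_⟩
      refine le_trans ?_ le_sup_left
      apply leaf_big a _ _ ha hn2
      · intro v hv; simpa using gS 1 h1 v hv
      · intro i v hv; exact gS _ (h2 i) v hv
  | insert κ K hκ ih =>
    intro S S' hcard n1 hn1 W hK hS hS' d1 d2 d3
    rw [Finset.card_insert_of_notMem hκ] at *
    rw [Finset.disjoint_insert_left] at d1 d2
    -- first: choose A κ
    obtain ⟨T1, hT1, hV1⟩ := ih S (insert κ S')
      (by rw [Finset.card_insert_of_notMem d2.1]; omega) n1 (by omega)
      (W ⊔ (Vd I J n1 (n2 + a)).map (LinearMap.mulLeft ℝ (A κ)))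
      (fun k hk v hv => Submodule.mem_sup_left (hK k (Finset.mem_insert_of_mem hk) v hv))
      (fun k hk v hv => Submodule.mem_sup_left (hS k hk v hv))
      (by
        intro k hk v hv
        rcases Finset.mem_insert.1 hk with rfl | hk
        · exact Submodule.mem_sup_right ⟨v, hv, rfl⟩
        · exact Submodule.mem_sup_left (hS' k hk v hv))
      d1.2 (by rw [Finset.disjoint_insert_right]; exact ⟨hκ, d2.2⟩)
      (by rw [Finset.disjoint_insert_right]; exact ⟨d1.1, d3⟩)
    obtain ⟨n, rfl⟩ : ∃ n, n1 = n + 1 := ⟨n1 - 1, by omega⟩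
    obtain ⟨T2, hT2, hV2⟩ := ih (insert κ S) S'
      (by rw [Finset.card_insert_of_notMem d1.1]; omega) n (by omega)
      (W.comap (LinearMap.mulLeft ℝ (A κ)))
      (by
        intro k hk v hv
        have := hK k (Finset.mem_insert_of_mem hk) (A κ * v) (Vd_mul (hAV κ) hv (by omega) (by omega))
        simp only [Submodule.mem_comap, LinearMap.mulLeft_apply]
        convert this using 1; ring)
      (by
        intro k hk v hv
        simp only [Submodule.mem_comap, LinearMap.mulLeft_apply]
        rcases Finset.mem_insert.1 hk with rfl | hk
        · have := hK k (Finset.mem_insert_self _ _) v hv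
          convert this using 1; ring
        · have := hS k hk (A κ * v) (Vd_mul (hAV κ) hv (by omega) (by omega))
          convert this using 1; ring)
      (by
        intro k hk v hv
        simp only [Submodule.mem_comap, LinearMap.mulLeft_apply]
        have := hS' k hk (A κ * v) (Vd_mul (hAV κ) hv (by omega) (by omega))
        convert this using 1; ring)
      (by rw [Finset.disjoint_insert_right]; exact ⟨hκ, d1.2⟩) d2.2
      (by rw [Finset.disjoint_insert_left]; exact ⟨d2.1, d3⟩)
    refine ⟨T1 ∪ T2.image (fun t => A κ * t), ?_, ?_⟩
    · rw [Finset.card_insert_of_notMem d1.1] at hT2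
      refine (Finset.card_union_le _ _).trans ?_
      have := Finset.card_image_le (s := T2) (f := fun t => A κ * t)
      simp only [Nct]
      omega
    · refine hV1.trans ?_
      rw [Finset.coe_union, Submodule.span_union]
      have key : (Vd I J (n + 1) (n2 + a)).map (LinearMap.mulLeft ℝ (A κ)) ≤
          W ⊔ Submodule.span ℝ ((T2.image (fun t => A κ * t) : Finset _) : Set (MvPolynomial (I ⊕ J) ℝ)) := by
        refine (Submodule.map_mono hV2).trans ?_
        rw [Submodule.map_sup, Submodule.map_span]
        apply sup_le_sup
        · exact Submodule.map_comap_le _ _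
        · apply Submodule.span_mono
          rintro _ ⟨t, ht, rfl⟩
          exact Finset.mem_coe.2 (Finset.mem_image.2 ⟨t, ht, rfl⟩)
      refine sup_le (sup_le le_sup_left (key.trans ?_)) ?_
      · exact sup_le_sup le_rfl le_sup_right
      · exact le_sup_of_le_right le_sup_left

end Warren

section Warren
set_option linter.unusedSectionVars false
open MvPolynomial

variable {I J : Type} [Fintype I] [Fintype J]

lemma cauchy_kill {P Q : Type*} [DecidableEq Q] (α : P → ℝ) (β : Q → ℝ) (hα : Function.Injective α)
    (hβ : Function.Injective β) (hpos : ∀ i j, 0 < α i + β j) (T : Finset P) (S : Finset Q)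
    (hc : S.card ≤ T.card) (u : Q → ℝ) (h : ∀ i ∈ T, ∑ j ∈ S, (1 / (α i + β j)) * u j = 0) :
    ∀ j ∈ S, u j = 0 := by
  classical
  let p : Polynomial ℝ := ∑ j ∈ S, Polynomial.C (u j) * ∏ k ∈ S.erase j, (Polynomial.X + Polynomial.C (β k))
  have hdeg : p.degree < T.card := by
    refine lt_of_le_of_lt (Polynomial.degree_sum_le _ _) ?_
    rw [Finset.sup_lt_iff (by exact WithBot.bot_lt_coe _)]
    intro j hj
    refine lt_of_le_of_lt (Polynomial.degree_mul_le_of_le Polynomial.degree_C_le le_rfl) ?_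
    rw [zero_add]
    rw [Polynomial.degree_prod]
    simp only [Polynomial.degree_X_add_C, Finset.sum_const, Finset.card_erase_of_mem hj]
    have : 0 < S.card := Finset.card_pos.2 ⟨j, hj⟩
    simp only [nsmul_eq_mul, mul_one]
    exact_mod_cast (by omega : S.card - 1 < T.card)
  have hp : p = 0 := by
    apply Polynomial.eq_zero_of_degree_lt_of_eval_index_eq_zero T hα.injOn hdeg
    intro i hi
    have : p.eval (α i) = (∏ k ∈ S, (α i + β k)) * ∑ j ∈ S, (1 / (α i + β j)) * u j := by
      simp only [p, Polynomial.eval_finsetSum, Polynomial.eval_mul, Polynomial.eval_C, Polynomial.eval_prod,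
        Polynomial.eval_add, Polynomial.eval_X, Finset.mul_sum]
      refine Finset.sum_congr rfl fun j hj => ?_
      rw [← Finset.mul_prod_erase S _ hj]
      have := (hpos i j).ne'
      field_simp
    rw [this, h i hi, mul_zero]
  intro j hj
  have he : p.eval (-β j) = u j * ∏ k ∈ S.erase j, (-β j + β k) := by
    simp only [p, Polynomial.eval_finsetSum, Polynomial.eval_mul, Polynomial.eval_C, Polynomial.eval_prod,
        Polynomial.eval_add, Polynomial.eval_X]
    apply Finset.sum_eq_single_of_mem j hj
    intro k hk hkj
    rw [Finset.prod_eq_zero (i := j)]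
    · simp
    · exact Finset.mem_erase.2 ⟨hkj.symm, hj⟩
    · simp
  rw [hp, Polynomial.eval_zero] at he
  rcases mul_eq_zero.1 he.symm with h0 | h0
  · exact h0
  · exfalso
    rw [Finset.prod_eq_zero_iff] at h0
    obtain ⟨k, hk, hk0⟩ := h0
    exact (Finset.ne_of_mem_erase hk) (hβ (by linarith))

/-- the vectors of coefficients -/
noncomputable def bvec [DecidableEq J] (c : Option I → Option J → ℝ) : I ⊕ J → (Option J → ℝ)
  | Sum.inl i => c (some i)
  | Sum.inr j => Pi.single (some j) 1

lemma fun_ext_lin [DecidableEq J] (f : (Option J → ℝ) →ₗ[ℝ] ℝ) (v : Option J → ℝ) :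
    f v = ∑ j, v j * f (Pi.single j 1) := by
  conv_lhs => rw [LinearMap.pi_apply_eq_sum_univ f v]
  simp only [smul_eq_mul]
  refine Finset.sum_congr rfl fun j _ => ?_
  congr 2
  ext k
  simp [Pi.single_apply, eq_comm]

lemma bvec_span [DecidableEq I] [DecidableEq J] (α : Option I → ℝ) (β : Option J → ℝ) (hα : Function.Injective α)
    (hβ : Function.Injective β) (hpos : ∀ i j, 0 < α i + β j) (S : Finset (I ⊕ J))
    (Y : Submodule ℝ (Option J → ℝ)) (hY : ∀ κ ∈ S, bvec (fun i j => 1 / (α i + β j)) κ ∈ Y)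
    (N : Finset (Option J)) (hN : ∀ j ∈ N, Pi.single j 1 ∈ Y) (hN2 : ∀ j, some j ∉ N)
    (hcard : Fintype.card J + 1 ≤ S.card + N.card) : Y = ⊤ := by
  by_contra hne
  obtain ⟨f, hf0, hf⟩ := Submodule.exists_le_ker_of_lt_top Y (lt_top_iff_ne_top.2 hne)
  apply hf0
  have hsplit : S.card = (Finset.univ.filter (fun i : I => Sum.inl i ∈ S)).card +
      (Finset.univ.filter (fun j : J => Sum.inr j ∈ S)).card := by
    rw [← Finset.card_toLeft_add_card_toRight (u := S)]
    congr 2 <;> ext <;> simp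
  set T := Finset.univ.filter (fun i : I => Sum.inl i ∈ S) with hT
  set E := Finset.univ.filter (fun j : J => Sum.inr j ∈ S) with hE
  let Q : Finset (Option J) := Finset.univ \ (E.map Function.Embedding.some ∪ N)
  have hQ : Q.card + E.card + N.card = Fintype.card J + 1 := by
    have hd : Disjoint (E.map Function.Embedding.some) N := by
      rw [Finset.disjoint_left]
      intro x hx hxN
      obtain ⟨j, _, rfl⟩ := Finset.mem_map.1 hx
      exact hN2 j hxN
    have h1 : (E.map Function.Embedding.some ∪ N).card = E.card + N.card := by
      rw [Finset.card_union_of_disjoint hd, Finset.card_map]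
    have h2 := Finset.card_sdiff_add_card_eq_card (Finset.subset_univ (E.map Function.Embedding.some ∪ N))
    rw [h1, Finset.card_univ, Fintype.card_option] at h2
    simp only [Q]
    omega
  have hu : ∀ j, j ∉ Q → f (Pi.single j 1) = 0 := by
    intro j hj
    have hj' : j ∈ E.map Function.Embedding.some ∪ N := by
      by_contra hcon
      exact hj (by simp only [Q, Finset.mem_sdiff, Finset.mem_univ, true_and]; exact hcon)
    rcases Finset.mem_union.1 hj' with h | h
    · obtain ⟨k, hk, rfl⟩ := Finset.mem_map.1 h
      have := hf (hY (Sum.inr k) (by simpa [hE] using hk))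
      simpa [bvec] using this
    · exact hf (hN j h)
  have hk := cauchy_kill (fun i : I => α (some i)) β (hα.comp (Option.some_injective _)) hβ (fun i j => hpos _ j)
    T Q (by omega) (fun j => f (Pi.single j 1)) (by
      intro i hi
      have h1 : f (bvec (fun i j => 1 / (α i + β j)) (Sum.inl i)) = 0 := 
        hf (hY (Sum.inl i) (by simpa [hT] using hi))
      rw [fun_ext_lin] at h1
      rw [← h1]
      apply Finset.sum_subset (Finset.subset_univ _)
      intro j _ hj
      rw [hu j hj, mul_zero])
  apply LinearMap.ext
  intro v
  rw [fun_ext_lin, LinearMap.zero_apply]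
  apply Finset.sum_eq_zero
  intro j _
  by_cases hj : j ∈ Q
  · rw [hk j hj, mul_zero]
  · rw [hu j hj, mul_zero]

lemma bvec_span1 [DecidableEq I] [DecidableEq J] (α : Option I → ℝ) (β : Option J → ℝ) (hα : Function.Injective α)
    (hβ : Function.Injective β) (hpos : ∀ i j, 0 < α i + β j) (S : Finset (I ⊕ J))
    (hcard : Fintype.card J + 1 ≤ S.card) {M : Type*} [AddCommGroup M] [Module ℝ M]
    (Φ : (Option J → ℝ) →ₗ[ℝ] M) (v : Option J → ℝ) :
    Φ v ∈ Submodule.span ℝ ((fun κ => Φ (bvec (fun i j => 1 / (α i + β j)) κ)) '' (S : Set (I ⊕ J))) := by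
  have := bvec_span α β hα hβ hpos S ((Submodule.span ℝ ((fun κ => Φ (bvec (fun i j => 1 / (α i + β j)) κ)) '' (S : Set (I ⊕ J)))).comap Φ)
    (fun κ hκ => Submodule.subset_span ⟨κ, hκ, rfl⟩) ∅ (by simp) (by simp) (by simpa using hcard)
  have h2 : v ∈ (⊤ : Submodule ℝ (Option J → ℝ)) := trivial
  rw [← this] at h2
  exact h2

lemma bvec_span2 [DecidableEq I] [DecidableEq J] (α : Option I → ℝ) (β : Option J → ℝ) (hα : Function.Injective α)
    (hβ : Function.Injective β) (hpos : ∀ i j, 0 < α i + β j) (S : Finset (I ⊕ J))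
    (hcard : S.card = Fintype.card J) {M : Type*} [AddCommGroup M] [Module ℝ M]
    (Φ : (Option J → ℝ) →ₗ[ℝ] M) (v : Option J → ℝ) :
    ∃ c : ℝ, Φ v - c • Φ (Pi.single none 1) ∈
      Submodule.span ℝ ((fun κ => Φ (bvec (fun i j => 1 / (α i + β j)) κ)) '' (S : Set (I ⊕ J))) := by
  have := bvec_span α β hα hβ hpos S ((Submodule.span ℝ ((fun κ => Φ (bvec (fun i j => 1 / (α i + β j)) κ)) '' (S : Set (I ⊕ J)))).comap Φ
    ⊔ Submodule.span ℝ {Pi.single none 1})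
    (fun κ hκ => Submodule.mem_sup_left (Submodule.subset_span ⟨κ, hκ, rfl⟩)) {none} 
    (by
      intro j hj
      rw [Finset.mem_singleton] at hj; subst hj
      exact Submodule.mem_sup_right (Submodule.subset_span rfl)) (by simp) (by simp [hcard])
  have h2 : v ∈ (⊤ : Submodule ℝ (Option J → ℝ)) := trivial
  rw [← this, Submodule.mem_sup] at h2
  obtain ⟨y, hy, z, hz, rfl⟩ := h2
  obtain ⟨c, rfl⟩ := Submodule.mem_span_singleton.1 hz
  refine ⟨c, ?_⟩
  rw [map_add, map_smul, add_sub_cancel_right]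
  exact hy

/-- basis elements `1, x_j^a` -/
noncomputable def Uel (I : Type) {J : Type} (a : ℕ) : Option J → MvPolynomial (I ⊕ J) ℝ
  | none => 1
  | some j => X (Sum.inr j) ^ a

/-- basis elements `1, λ_i` -/
noncomputable def Lel {I : Type} (J : Type) : Option I → MvPolynomial (I ⊕ J) ℝ
  | none => 1
  | some i => X (Sum.inl i)

/-- the `λ`-type factors -/
noncomputable def Afac (c : Option I → Option J → ℝ) : I ⊕ J → MvPolynomial (I ⊕ J) ℝ
  | Sum.inl i => X (Sum.inl i)
  | Sum.inr j => ∑ i, c i (some j) • Lel J i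

/-- the `x`-type factors -/
noncomputable def Bfac (a : ℕ) (c : Option I → Option J → ℝ) : I ⊕ J → MvPolynomial (I ⊕ J) ℝ
  | Sum.inl i => ∑ j, c (some i) j • Uel I a j
  | Sum.inr j => X (Sum.inr j) ^ a

lemma Afac_mem (c : Option I → Option J → ℝ) (κ : I ⊕ J) : Afac c κ ∈ Vd I J 1 0 := by
  rcases κ with i | j
  · exact Vd_inl i
  · refine Submodule.sum_mem _ fun i _ => Submodule.smul_mem _ _ ?_
    rcases i with _ | i
    · exact Vd_one
    · exact Vd_inl i

lemma Bfac_mem (a : ℕ) (c : Option I → Option J → ℝ) (κ : I ⊕ J) : Bfac a c κ ∈ Vd I J 0 a := by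
  rcases κ with i | j
  · refine Submodule.sum_mem _ fun i _ => Submodule.smul_mem _ _ ?_
    rcases i with _ | i
    · exact Vd_one
    · exact Vd_inr_pow i a
  · exact Vd_inr_pow j a

/-- the spanning set at the special parameter -/
lemma special_span [DecidableEq I] [DecidableEq J] (a n2 : ℕ) (ha : 1 ≤ a)
    (hn2 : Fintype.card J * a ≤ n2) (α : Option I → ℝ) (β : Option J → ℝ) (hα : Function.Injective α)
    (hβ : Function.Injective β) (hpos : ∀ i j, 0 < α i + β j)
    (c : Option I → Option J → ℝ) (hc : c = fun i j => 1 / (α i + β j))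
    (W : Submodule ℝ (MvPolynomial (I ⊕ J) ℝ))
    (hW : ∀ κ, ∀ v ∈ Vd I J (Fintype.card I + Fintype.card J) n2, Afac c κ * Bfac a c κ * v ∈ W) :
    ∃ T : Finset (MvPolynomial (I ⊕ J) ℝ),
        T.card ≤ (Fintype.card I + Fintype.card J).choose (Fintype.card J) * (a ^ Fintype.card J) ∧
        Vd I J (Fintype.card I + Fintype.card J + 1) (n2 + a) ≤
          W ⊔ Submodule.span ℝ (T : Set (MvPolynomial (I ⊕ J) ℝ)) := by
  subst hc
  set c : Option I → Option J → ℝ := fun i j => 1 / (α i + β j) with hc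
  let Φ : (Option J → ℝ) →ₗ[ℝ] MvPolynomial (I ⊕ J) ℝ := Fintype.linearCombination ℝ (Uel I a)
  let Ψ : (Option I → ℝ) →ₗ[ℝ] MvPolynomial (I ⊕ J) ℝ := Fintype.linearCombination ℝ (Lel J)
  have hΦs : ∀ j, Φ (Pi.single j 1) = Uel I a j := by
    intro j; simp [Φ, Fintype.linearCombination_apply_single]
  have hΨs : ∀ j, Ψ (Pi.single j 1) = Lel J j := by
    intro j; simp [Ψ, Fintype.linearCombination_apply_single]
  let c' : Option J → Option I → ℝ := fun j i => 1 / (β j + α i)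
  have hB : Bfac a c = fun κ => Φ (bvec c κ) := by
    funext κ
    rcases κ with i | j
    · simp [Bfac, bvec, Φ, Fintype.linearCombination_apply]
    · simp only [Bfac, bvec]; rw [hΦs]; rfl
  have hA : Afac c = (fun κ => Ψ (bvec c' κ)) ∘ Sum.swap := by
    funext κ
    rcases κ with i | j
    · simp only [Afac, bvec, Function.comp, Sum.swap_inl]; rw [hΨs]; rfl
    · simp only [Afac, bvec, Function.comp, Sum.swap_inr, Ψ, Fintype.linearCombination_apply, c, c']
      exact Finset.sum_congr rfl fun i _ => by rw [add_comm]
  have hAS : ∀ S : Finset (I ⊕ J), (Afac c) '' (S : Set (I ⊕ J)) =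
      (fun κ => Ψ (bvec c' κ)) '' ((S.map (Equiv.sumComm I J).toEmbedding : Finset (J ⊕ I)) : Set (J ⊕ I)) := by
    intro S
    rw [hA, Set.image_comp, Finset.coe_map]
    rfl
  have hpos' : ∀ j i, 0 < β j + α i := fun j i => by rw [add_comm]; exact hpos i j
  have := splitting a n2 ha hn2 (Afac c) (Bfac a c) (Afac_mem c) 
    (by
      intro S hS
      rw [hB]
      have h := bvec_span1 α β hα hβ hpos S hS Φ
      refine ⟨?_, fun j => ?_⟩
      · have h' := h (Pi.single none 1)
        rw [hΦs] at h'
        exact h'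
      · have h' := h (Pi.single (some j) 1)
        rw [hΦs] at h'
        exact h')
    (by
      intro S hS
      rw [hAS]
      have h := bvec_span1 β α hβ hα hpos' (S.map (Equiv.sumComm I J).toEmbedding) 
        (by rw [Finset.card_map]; exact hS) Ψ
      refine ⟨?_, fun j => ?_⟩
      · have h' := h (Pi.single none 1)
        rw [hΨs] at h'
        exact h'
      · have h' := h (Pi.single (some j) 1)
        rw [hΨs] at h'
        exact h')
    (by
      intro S hS j
      rw [hB]
      obtain ⟨r, hr⟩ := bvec_span2 α β hα hβ hpos S hS Φ (Pi.single (some j) 1)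
      refine ⟨r, ?_⟩
      rw [hΦs, hΦs] at hr
      simpa only [Uel, smul_eq_C_mul, mul_one] using hr)
    (by
      intro S hS j
      rw [hAS]
      obtain ⟨r, hr⟩ := bvec_span2 β α hβ hα hpos' (S.map (Equiv.sumComm I J).toEmbedding) 
        (by rw [Finset.card_map]; exact hS) Ψ (Pi.single (some j) 1)
      refine ⟨r, ?_⟩
      rw [hΨs, hΨs] at hr
      simpa only [Lel, smul_eq_C_mul, mul_one] using hr)
    Finset.univ ∅ ∅ (by simp) (Fintype.card I + Fintype.card J) (by simp) W
    (fun κ _ => hW κ) (by simp) (by simp) (by simp) (by simp) (by simp)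
  obtain ⟨T, hT, hV⟩ := this
  refine ⟨T, ?_, hV⟩
  rw [Nct_eq] at hT
  simpa using hT

/-- generic parameter -/
lemma generic_span (n1 n2 k1 k2 : ℕ) (g δ : I ⊕ J → MvPolynomial (I ⊕ J) ℝ)
    (hδ : ∀ κ, δ κ ∈ Vd I J k1 k2)
    (T : Finset (MvPolynomial (I ⊕ J) ℝ))
    (hV : ∀ W : Submodule ℝ (MvPolynomial (I ⊕ J) ℝ), 
      (∀ κ, ∀ v ∈ Vd I J n1 n2, g κ * v ∈ W) → Vd I J (n1 + k1) (n2 + k2) ≤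
          W ⊔ Submodule.span ℝ (T : Set (MvPolynomial (I ⊕ J) ℝ))) :
    ∃ F : Set ℝ, F.Finite ∧ ∀ s, 0 < s → s ∉ F → ∀ W : Submodule ℝ (MvPolynomial (I ⊕ J) ℝ),
      (∀ κ, ∀ v : MvPolynomial (I ⊕ J) ℝ, (g κ + s • δ κ) * v ∈ W) → Vd I J (n1 + k1) (n2 + k2) ≤
          W ⊔ Submodule.span ℝ (T : Set (MvPolynomial (I ⊕ J) ℝ)) := by
  classical
  let Sp := Submodule.span ℝ (T : Set (MvPolynomial (I ⊕ J) ℝ))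
  let Ξ : ((I ⊕ J → Vd I J n1 n2) × Sp) →ₗ[ℝ] MvPolynomial (I ⊕ J) ℝ :=
    LinearMap.coprod (∑ κ, (LinearMap.mulLeft ℝ (g κ)) ∘ₗ (Vd I J n1 n2).subtype ∘ₗ LinearMap.proj κ) Sp.subtype
  have hΞ : ∀ w b, Ξ (w, b) = ∑ κ, g κ * (w κ : MvPolynomial (I ⊕ J) ℝ) + b := by
    intro w b; simp [Ξ]
  have hle : Vd I J (n1 + k1) (n2 + k2) ≤ LinearMap.range Ξ := by
    refine (hV (LinearMap.range Ξ) ?_).trans (sup_le le_rfl ?_)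
    · intro κ v hv
      refine ⟨(Pi.single κ ⟨v, hv⟩, 0), ?_⟩
      rw [hΞ, Finset.sum_eq_single κ]
      · simp
      · intro k _ hk; simp [Pi.single_eq_of_ne hk]
      · simp
    · intro b hb
      refine ⟨(0, ⟨b, hb⟩), ?_⟩
      rw [hΞ]; simp
  obtain ⟨ρ, hρ⟩ := Module.projective_lifting_property Ξ.rangeRestrict (Submodule.inclusion hle)
    Ξ.surjective_rangeRestrict
  have hρ' : ∀ v, Ξ (ρ v) = (v : MvPolynomial (I ⊕ J) ℝ) := by
    intro v
    have := congrArg Subtype.val (LinearMap.congr_fun hρ v)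
    simpa using this
  let Th : Vd I J (n1 + k1) (n2 + k2) →ₗ[ℝ] Vd I J (n1 + k1) (n2 + k2) :=
    LinearMap.codRestrict _ 
      ((∑ κ, (LinearMap.mulLeft ℝ (δ κ)) ∘ₗ (Vd I J n1 n2).subtype ∘ₗ LinearMap.proj κ) ∘ₗ LinearMap.fst ℝ _ Sp ∘ₗ ρ)
      (by
        intro v
        simp only [LinearMap.comp_apply, LinearMap.sum_apply]
        refine Submodule.sum_mem _ fun κ _ => ?_
        exact Vd_mul (hδ κ) ((ρ v).1 κ).2 (by omega) (by omega))
  have hTh : ∀ v, (Th v : MvPolynomial (I ⊕ J) ℝ) = ∑ κ, δ κ * ((ρ v).1 κ : MvPolynomial (I ⊕ J) ℝ) := by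
    intro v; simp [Th]
  refine ⟨(fun μ : ℝ => -1 / μ) '' {μ | Module.End.HasEigenvalue Th μ}, (Module.End.finite_hasEigenvalue Th).image _, ?_⟩
  intro s hs hsF W hW
  have hinj : Function.Injective ((LinearMap.id + s • Th : Vd I J (n1 + k1) (n2 + k2) →ₗ[ℝ] Vd I J (n1 + k1) (n2 + k2))) := by
    rw [← LinearMap.ker_eq_bot, LinearMap.ker_eq_bot']
    intro v hv
    by_contra hv0
    apply hsF
    refine ⟨-1/s, ?_, by field_simp⟩
    apply Module.End.hasEigenvalue_of_hasEigenvector (x := v)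
    refine ⟨?_, hv0⟩
    rw [Module.End.mem_eigenspace_iff]
    have h1 : v + s • Th v = 0 := hv
    have h2 : Th v = s⁻¹ • (s • Th v) := by rw [smul_smul, inv_mul_cancel₀ hs.ne', one_smul]
    rw [h2, eq_neg_of_add_eq_zero_right h1, smul_neg, ← neg_smul]
    congr 1
    field_simp
  have hsurj := LinearMap.surjective_of_injective hinj
  intro v hv
  obtain ⟨x, hx⟩ := hsurj ⟨v, hv⟩
  have hx' : (x : MvPolynomial (I ⊕ J) ℝ) + s • (Th x : MvPolynomial (I ⊕ J) ℝ) = v := by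
    have := congrArg Subtype.val hx
    simpa using this
  rw [← hx', ← hρ' x, hTh x]
  have : Ξ (ρ x) = ∑ κ, g κ * ((ρ x).1 κ : MvPolynomial (I ⊕ J) ℝ) + (ρ x).2 := hΞ _ _
  rw [this, Finset.smul_sum, add_right_comm, ← Finset.sum_add_distrib]
  refine add_mem (Submodule.mem_sup_left (Submodule.sum_mem _ fun κ _ => ?_)) (Submodule.mem_sup_right (ρ x).2.2)
  have := hW κ ((ρ x).1 κ)
  rwa [add_mul, smul_mul_assoc] at this

end Warren

section Warren
set_option linter.unusedSectionVars false
open MvPolynomial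

variable {I J : Type} [Fintype I] [Fintype J]

lemma hasDerivAt_eval [DecidableEq J] (p : MvPolynomial J ℝ) (z : J → ℝ) (j : J) (t : ℝ) :
    HasDerivAt (fun t => eval (Function.update z j t) p) (eval (Function.update z j t) (pderiv j p)) t := by
  induction p using MvPolynomial.induction_on with
  | C a => simpa using hasDerivAt_const t a
  | add p q hp hq =>
    simp only [map_add]
    exact hp.add hq
  | mul_X p k hp =>
    have hX : HasDerivAt (fun t => eval (Function.update z j t) (X k : MvPolynomial J ℝ))
        (eval (Function.update z j t) (pderiv j (X k))) t := by
      by_cases h : k = j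
      · subst h
        simp only [eval_X, Function.update_self, pderiv_X_self, map_one]
        exact hasDerivAt_id' t
      · have : pderiv j (X k : MvPolynomial J ℝ) = 0 := pderiv_X_of_ne h
        rw [this]
        simpa [Function.update_of_ne h] using hasDerivAt_const t (z k)
    have := hp.mul hX
    have e : eval (Function.update z j t) (pderiv j (p * X k)) =
      eval (Function.update z j t) ((pderiv j) p) * eval (Function.update z j t) (X k) +
        eval (Function.update z j t) p * eval (Function.update z j t) ((pderiv j) (X k)) := by
      rw [Derivation.leibniz]
      simp only [smul_eq_mul, map_add, map_mul]
      ring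
    have e2 : (fun t => eval (Function.update z j t) (p * X k)) =
        (fun t => eval (Function.update z j t) p) * fun t => eval (Function.update z j t) (X k) := by
      funext t; simp
    rw [e, e2]
    exact this

lemma growth (q : MvPolynomial J ℝ) : ∀ ε : ℝ, 0 < ε → ∃ K : ℝ, 0 < K ∧ ∀ x : J → ℝ, (∀ j, 0 ≤ x j) →
    |eval x q| ≤ K * Real.exp (ε * ∑ j, x j) := by
  induction q using MvPolynomial.induction_on with
  | C a =>
    intro ε hε
    refine ⟨|a| + 1, by positivity, fun x hx => ?_⟩
    have h1 : 0 ≤ ε * ∑ j, x j := mul_nonneg hε.le (Finset.sum_nonneg fun j _ => hx j)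
    have h2 := Real.one_le_exp h1
    rw [eval_C]
    nlinarith [abs_nonneg a]
  | add p q hp hq =>
    intro ε hε
    obtain ⟨K1, h1, H1⟩ := hp ε hε
    obtain ⟨K2, h2, H2⟩ := hq ε hε
    refine ⟨K1 + K2, by positivity, fun x hx => ?_⟩
    rw [map_add, add_mul]
    exact (abs_add_le _ _).trans (add_le_add (H1 x hx) (H2 x hx))
  | mul_X p k hp =>
    intro ε hε
    obtain ⟨K, h1, H⟩ := hp (ε / 2) (by positivity)
    refine ⟨K * (2 / ε), by positivity, fun x hx => ?_⟩
    rw [map_mul, eval_X, abs_mul, abs_of_nonneg (hx k)]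
    have h2 : x k ≤ 2 / ε * Real.exp (ε / 2 * ∑ j, x j) := by
      have h3 : x k ≤ ∑ j, x j := Finset.single_le_sum (fun j _ => hx j) (Finset.mem_univ k)
      have h4 := Real.add_one_le_exp (ε / 2 * ∑ j, x j)
      rw [div_mul_eq_mul_div, le_div_iff₀ hε]
      nlinarith
    calc |eval x p| * x k ≤ (K * Real.exp (ε / 2 * ∑ j, x j)) * (2 / ε * Real.exp (ε / 2 * ∑ j, x j)) :=
          mul_le_mul (H x hx) h2 (hx k) (by positivity)
      _ = K * (2 / ε) * (Real.exp (ε / 2 * ∑ j, x j) * Real.exp (ε / 2 * ∑ j, x j)) := by ring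
      _ = _ := by rw [← Real.exp_add]; congr 2; ring

lemma crit_point [DecidableEq J] (P : I → MvPolynomial J ℝ) (a : ℕ) (ha : 1 ≤ a) (c : J → ℝ) (k : ℝ)
    (hk : 0 < k) (hc : ∀ j, k ≤ c j) (s : ℝ) (hs : 0 < s) (x0 : J → ℝ) (hx0 : ∀ j, 0 < x0 j)
    (hP0 : ∀ i, 0 < eval x0 (P i)) :
    ∃ z : J → ℝ, (∀ j, 0 < z j) ∧ (∀ i, 0 < eval z (P i)) ∧
      ∀ j, c j * (a * z j ^ a) = s * (∑ i, z j * eval z (pderiv j (P i)) / eval z (P i) + 1) := by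
  let F0 : MvPolynomial J ℝ := ∑ j, C (c j) * X j ^ a
  have hF0 : ∀ x, eval x F0 = ∑ j, c j * x j ^ a := by intro x; simp [F0]
  let q : MvPolynomial J ℝ := (∏ i, P i) * ∏ j, X j
  have hq : ∀ x, eval x q = (∏ i, eval x (P i)) * ∏ j, x j := by intro x; simp [q, map_prod]
  let H : (J → ℝ) → ℝ := fun x => Real.exp (-(eval x F0) / s) * eval x q
  have hHc : Continuous H := by
    have h1 : Continuous fun x : J → ℝ => eval x F0 := MvPolynomial.continuous_eval F0
    have h2 : Continuous fun x : J → ℝ => eval x q := MvPolynomial.continuous_eval q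
    exact (Real.continuous_exp.comp (h1.neg.div_const s)).mul h2
  let Cl : Set (J → ℝ) := {x | (∀ j, 0 ≤ x j) ∧ ∀ i, 0 ≤ eval x (P i)}
  have hCl : IsClosed Cl := by
    have : Cl = (⋂ j, {x | 0 ≤ x j}) ∩ ⋂ i, {x | 0 ≤ eval x (P i)} := by
      ext x; simp [Cl]
    rw [this]
    refine IsClosed.inter (isClosed_iInter fun j => isClosed_le continuous_const (continuous_apply j))
      (isClosed_iInter fun i => isClosed_le continuous_const (MvPolynomial.continuous_eval (P i)))
  have hH0 : 0 < H x0 := by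
    simp only [H, hq]
    have h1 := Finset.prod_pos (s := Finset.univ) fun i _ => hP0 i
    have h2 := Finset.prod_pos (s := Finset.univ) fun i _ => hx0 i
    positivity
  have hx0C : x0 ∈ Cl := ⟨fun j => (hx0 j).le, fun i => (hP0 i).le⟩
  -- decay
  obtain ⟨R, hR⟩ : ∃ R : ℝ, ∀ x ∈ Cl, H x0 ≤ H x → ∑ j, x j ≤ R := by
    obtain ⟨K, hK, HK⟩ := growth q (k / (2 * s)) (by positivity)
    let n : ℝ := Fintype.card J
    refine ⟨(k * n / s - Real.log (H x0 / K)) / (k / (2 * s)), fun x hx hle => ?_⟩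
    rw [le_div_iff₀ (by positivity)]
    have hF : k * (∑ j, x j - n) ≤ eval x F0 := by
      rw [hF0]
      have : k * (∑ j, x j - n) = ∑ j, k * (x j - 1) := by
        rw [← Finset.mul_sum, Finset.sum_sub_distrib]; simp [n]
      rw [this]
      refine Finset.sum_le_sum fun j _ => ?_
      have hxj := hx.1 j
      have h1 : x j - 1 ≤ x j ^ a := by
        by_cases h : x j ≤ 1
        · have : 0 ≤ x j ^ a := by positivity
          linarith
        · have := le_self_pow₀ (a := x j) (by linarith) (show a ≠ 0 by omega)
          linarith
      have h2 : 0 ≤ x j ^ a := by positivity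
      calc k * (x j - 1) ≤ k * x j ^ a := mul_le_mul_of_nonneg_left h1 hk.le
        _ ≤ c j * x j ^ a := mul_le_mul_of_nonneg_right (hc j) h2
    have h3 : H x0 ≤ K * Real.exp (k * n / s - k / (2 * s) * ∑ j, x j) := by
      refine hle.trans ?_
      calc H x ≤ Real.exp (-(eval x F0) / s) * (K * Real.exp (k / (2 * s) * ∑ j, x j)) := by
            apply mul_le_mul_of_nonneg_left _ (Real.exp_pos _).le
            exact (le_abs_self _).trans (HK x hx.1)
        _ = K * Real.exp (-(eval x F0) / s + k / (2 * s) * ∑ j, x j) := by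
            rw [Real.exp_add]; ring
        _ ≤ _ := by
            apply mul_le_mul_of_nonneg_left _ hK.le
            apply Real.exp_le_exp.2
            have : -(eval x F0) / s ≤ -(k * (∑ j, x j - n)) / s := by gcongr
            have e : -(k * (∑ j, x j - n)) / s = k * n / s - 2 * (k / (2 * s) * ∑ j, x j) := by
              field_simp; ring
            linarith
    have h4 : Real.log (H x0 / K) ≤ k * n / s - k / (2 * s) * ∑ j, x j := by
      rw [Real.log_le_iff_le_exp (by positivity), div_le_iff₀ hK]
      linarith
    linarith
  let Kc : Set (J → ℝ) := Cl ∩ Set.Icc 0 (fun _ => R)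
  have hKc : IsCompact Kc := isCompact_Icc.inter_left hCl
  have hmem : ∀ x ∈ Cl, H x0 ≤ H x → x ∈ Kc := by
    intro x hx hle
    refine ⟨hx, fun j => hx.1 j, fun j => ?_⟩
    exact (Finset.single_le_sum (fun j _ => hx.1 j) (Finset.mem_univ j)).trans (hR x hx hle)
  obtain ⟨z, hzK, hzmax⟩ := hKc.exists_isMaxOn ⟨x0, hmem x0 hx0C le_rfl⟩ hHc.continuousOn
  have hz0 : H x0 ≤ H z := hzmax (hmem x0 hx0C le_rfl)
  have hmax : ∀ x ∈ Cl, H x ≤ H z := by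
    intro x hx
    by_cases h : H x0 ≤ H x
    · exact hzmax (hmem x hx h)
    · linarith
  have hqz : eval z q ≠ 0 := by
    intro h0
    have : H z = 0 := by simp only [H, h0, mul_zero]
    linarith
  rw [hq] at hqz
  have hzP : ∀ i, 0 < eval z (P i) := fun i =>
    lt_of_le_of_ne (hzK.1.2 i) (Ne.symm (Finset.prod_ne_zero_iff.1 (left_ne_zero_of_mul hqz) i (Finset.mem_univ i)))
  have hzx : ∀ j, 0 < z j := fun j =>
    lt_of_le_of_ne (hzK.1.1 j) (Ne.symm (Finset.prod_ne_zero_iff.1 (right_ne_zero_of_mul hqz) j (Finset.mem_univ j)))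
  refine ⟨z, hzx, hzP, fun j => ?_⟩
  -- log version
  let Lg : (J → ℝ) → ℝ := fun x => ∑ i, Real.log (eval x (P i)) + ∑ l, Real.log (eval x (X l : MvPolynomial J ℝ)) - eval x F0 / s
  have hLg : ∀ x, (∀ j, 0 < x j) → (∀ i, 0 < eval x (P i)) → H x = Real.exp (Lg x) := by
    intro x h1 h2
    simp only [H, Lg, hq, eval_X]
    rw [Real.exp_sub, Real.exp_add, Real.exp_sum, Real.exp_sum, neg_div, Real.exp_neg]
    simp only [Real.exp_log (h1 _), Real.exp_log (h2 _)]
    rw [div_eq_mul_inv]; ring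
  have hO : IsOpen {x : J → ℝ | (∀ j, 0 < x j) ∧ ∀ i, 0 < eval x (P i)} := by
    have : {x : J → ℝ | (∀ j, 0 < x j) ∧ ∀ i, 0 < eval x (P i)} =
        (⋂ j, {x | 0 < x j}) ∩ ⋂ i, {x | 0 < eval x (P i)} := by
      ext x; simp
    rw [this]
    refine IsOpen.inter (isOpen_iInter_of_finite fun j => isOpen_lt continuous_const (continuous_apply j))
      (isOpen_iInter_of_finite fun i => isOpen_lt continuous_const (MvPolynomial.continuous_eval (P i)))
  have hup : Function.update z j (z j) = z := Function.update_eq_self j z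
  have hloc : IsLocalMax (fun t => Lg (Function.update z j t)) (z j) := by
    have hcont : Continuous (fun t : ℝ => Function.update z j t) := continuous_const.update j continuous_id
    have := hcont.continuousAt.preimage_mem_nhds (x := z j) (hO.mem_nhds (by rw [hup]; exact ⟨hzx, hzP⟩))
    filter_upwards [this] with t ht
    have h1 := hmax _ ⟨fun j => (ht.1 j).le, fun i => (ht.2 i).le⟩
    rw [hLg _ ht.1 ht.2, hLg _ hzx hzP, Real.exp_le_exp] at h1
    rw [hup]; exact h1
  have hder : HasDerivAt (fun t => Lg (Function.update z j t))
      (∑ i, eval z (pderiv j (P i)) / eval z (P i) + ∑ l, eval z (pderiv j (X l)) / eval z (X l : MvPolynomial J ℝ)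
        - eval z (pderiv j F0) / s) (z j) := by
    refine HasDerivAt.sub (HasDerivAt.add (HasDerivAt.fun_sum fun i _ => ?_) (HasDerivAt.fun_sum fun l _ => ?_)) ?_
    · have := (hasDerivAt_eval (P i) z j (z j)).log (by rw [hup]; exact (hzP i).ne')
      rwa [hup] at this
    · have := (hasDerivAt_eval (X l) z j (z j)).log (by rw [hup, eval_X]; exact (hzx l).ne')
      rwa [hup] at this
    · have := (hasDerivAt_eval F0 z j (z j)).div_const s
      rwa [hup] at this
  have h0 := hloc.hasDerivAt_eq_zero hder
  have e1 : ∑ l, eval z (pderiv j (X l)) / eval z (X l : MvPolynomial J ℝ) = 1 / z j := by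
    rw [Finset.sum_eq_single j]
    · simp
    · intro l _ hl; rw [pderiv_X_of_ne hl]; simp
    · simp
  have e2 : eval z (pderiv j F0) = c j * (a * z j ^ (a - 1)) := by
    simp only [F0, map_sum]
    rw [Finset.sum_eq_single j]
    · simp [pderiv_C_mul, pderiv_pow]
    · intro l _ hl; simp [pderiv_C_mul, pderiv_pow, pderiv_X_of_ne hl]
    · simp
  rw [e1, e2] at h0
  have hz := (hzx j).ne'
  have e3 : z j ^ a = z j * z j ^ (a - 1) := by
    rw [← pow_succ']; congr 1; omega
  have e4 : ∑ i, z j * eval z (pderiv j (P i)) / eval z (P i) = z j * ∑ i, eval z (pderiv j (P i)) / eval z (P i) := by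
    rw [Finset.mul_sum]; exact Finset.sum_congr rfl fun i _ => by ring
  rw [e3, e4]
  set sg := ∑ i, eval z (pderiv j (P i)) / eval z (P i)
  field_simp at h0
  linarith

end Warren

section Warren
set_option linter.unusedSectionVars false
open MvPolynomial

variable {I J : Type} [Fintype I] [Fintype J]

lemma rename_monomial_mem (a : ℕ) (e : J →₀ ℕ) (he : (e.sum fun _ n => n) ≤ a) (c : ℝ) :
    rename Sum.inr (monomial e c) ∈ Vd I J 0 a := by
  classical
  rw [rename_monomial]
  apply monomial_mem_Vd
  · refine le_of_eq (Finset.sum_eq_zero fun i _ => ?_)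
    apply Finsupp.mapDomain_of_notMem_range
    simp
  · refine le_trans (le_of_eq ?_) he
    rw [Finsupp.sum_fintype _ _ (fun _ => rfl)]
    exact Finset.sum_congr rfl fun j _ => Finsupp.mapDomain_apply Sum.inr_injective e j

lemma rename_mem_Vd (a : ℕ) (p : MvPolynomial J ℝ) (hp : p.totalDegree ≤ a) :
    rename Sum.inr p ∈ Vd I J 0 a := by
  rw [p.as_sum, map_sum]
  refine Submodule.sum_mem _ fun e he => rename_monomial_mem a e ?_ _
  exact (le_totalDegree he).trans hp

lemma rename_pderiv_mem_Vd (a : ℕ) (p : MvPolynomial J ℝ) (hp : p.totalDegree ≤ a) (j : J) :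
    rename Sum.inr (X j * pderiv j p) ∈ Vd I J 0 a := by
  classical
  have : X j * pderiv j p = ∑ e ∈ p.support, (e j) • monomial e (coeff e p) := by
    conv_lhs => rw [p.as_sum]
    rw [map_sum, Finset.mul_sum]
    exact Finset.sum_congr rfl fun e _ => X_mul_pderiv_monomial
  rw [this, map_sum]
  refine Submodule.sum_mem _ fun e he => ?_
  rw [map_nsmul]
  exact Submodule.smul_of_tower_mem _ _ (rename_monomial_mem a e ((le_totalDegree he).trans hp) _)

lemma totalDegree_bind_le (f : J → MvPolynomial J ℝ) (hf : ∀ j, (f j).totalDegree ≤ 1)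
    (p : MvPolynomial J ℝ) : (bind₁ f p).totalDegree ≤ p.totalDegree := by
  classical
  conv_lhs => rw [p.as_sum]
  rw [map_sum]
  refine totalDegree_finsetSum_le fun e he => ?_
  rw [bind₁_monomial]
  refine (totalDegree_mul _ _).trans ?_
  rw [totalDegree_C, zero_add]
  refine (totalDegree_finsetProd _ _).trans ?_
  refine le_trans (Finset.sum_le_sum fun j _ => ?_) (le_totalDegree he)
  refine (totalDegree_pow _ _).trans ?_
  exact (Nat.mul_le_mul_left (e j) (hf j)).trans (mul_one (e j)).le

lemma eval_count [Nonempty J] {K : Type} [Fintype K] (n1 n2 : ℕ) (y : K → I ⊕ J → ℝ)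
    (hy : ∀ k l, k ≠ l → ∃ j, y k (Sum.inr j) ≠ y l (Sum.inr j))
    (T : Finset (MvPolynomial (I ⊕ J) ℝ)) (hn : Fintype.card K ≤ n2 + 1)
    (hT : ∀ W : Submodule ℝ (MvPolynomial (I ⊕ J) ℝ), (∀ f, (∀ k, eval (y k) f = 0) → f ∈ W) →
      Vd I J n1 n2 ≤ W ⊔ Submodule.span ℝ (T : Set (MvPolynomial (I ⊕ J) ℝ))) :
    Fintype.card K ≤ T.card := by
  classical
  let ev : MvPolynomial (I ⊕ J) ℝ →ₗ[ℝ] (K → ℝ) := LinearMap.pi fun k => (aeval (y k)).toLinearMap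
  have hev : ∀ f k, ev f k = eval (y k) f := by
    intro f k
    simp [ev]
  have h1 := hT (LinearMap.ker ev) (fun f hf => by
    rw [LinearMap.mem_ker]; funext k; rw [hev, hf]; rfl)
  have h2 : (⊤ : Submodule ℝ (K → ℝ)) ≤ Submodule.map ev (Vd I J n1 n2) := by
    rw [← (Pi.basisFun ℝ K).span_eq, Submodule.span_le]
    rintro _ ⟨k, rfl⟩
    choose! jj hjj using fun l => hy k l
    have hm : ∀ S : Finset K, (∏ l ∈ S, (X (Sum.inr (jj l)) - C (y l (Sum.inr (jj l)))) :
        MvPolynomial (I ⊕ J) ℝ) ∈ Vd I J 0 S.card := by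
      intro S
      induction S using Finset.induction_on with
      | empty => simpa using Vd_one
      | insert l S hl ih =>
        rw [Finset.prod_insert hl, Finset.card_insert_of_notMem hl]
        exact Vd_mul (Submodule.sub_mem _ (Vd_inr _) (Vd_C _)) ih (by omega) (by omega)
    let f : MvPolynomial (I ⊕ J) ℝ := ∏ l ∈ Finset.univ.erase k, (X (Sum.inr (jj l)) - C (y l (Sum.inr (jj l))))
    have hf : f ∈ Vd I J n1 n2 := by
      refine Vd_mono (Nat.zero_le _) ?_ (hm _)
      rw [Finset.card_erase_of_mem (Finset.mem_univ k), Finset.card_univ]; omega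
    have hfk : eval (y k) f ≠ 0 := by
      simp only [f, map_prod, map_sub, eval_X, eval_C]
      refine Finset.prod_ne_zero_iff.2 fun l hl => sub_ne_zero.2 ?_
      exact hjj l (Finset.ne_of_mem_erase hl).symm
    have hfl : ∀ l, l ≠ k → eval (y l) f = 0 := by
      intro l hl
      simp only [f, map_prod, map_sub, eval_X, eval_C]
      exact Finset.prod_eq_zero (Finset.mem_erase.2 ⟨hl, Finset.mem_univ l⟩) (sub_self _)
    refine ⟨(eval (y k) f)⁻¹ • f, Submodule.smul_mem _ _ hf, ?_⟩
    funext l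
    rw [map_smul, Pi.smul_apply, hev, Pi.basisFun_apply]
    by_cases h : l = k
    · subst h; simp [hfk]
    · rw [hfl l h]; simp [h]
  have h3 : (⊤ : Submodule ℝ (K → ℝ)) ≤ Submodule.span ℝ (T.image ev : Set (K → ℝ)) := by
    refine h2.trans ((Submodule.map_mono h1).trans ?_)
    rw [Submodule.map_sup, Submodule.map_span]
    refine sup_le ?_ (by simp)
    rintro _ ⟨f, hf, rfl⟩
    rw [LinearMap.mem_ker.1 hf]; exact Submodule.zero_mem _
  have h4 := finrank_span_finset_le_card (R := ℝ) (T.image ev)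
  have h5 : Set.finrank ℝ ((T.image ev : Finset (K → ℝ)) : Set (K → ℝ)) = Fintype.card K := by
    rw [Set.finrank, top_le_iff.1 h3, finrank_top, Module.finrank_fintype_fun_eq_card]
  have h6 := Finset.card_image_le (s := T) (f := ev)
  omega

end Warren

section Warren
set_option linter.unusedSectionVars false
open MvPolynomial

variable {I J : Type} [Fintype I] [Fintype J]

set_option maxHeartbeats 400000 in
lemma count_pos [Nonempty J] {K : Type} [Fintype K] (a : ℕ) (ha : 1 ≤ a)
    (p : I → MvPolynomial J ℝ) (hp : ∀ i, (p i).totalDegree ≤ a) (x : K → J → ℝ)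
    (hx : ∀ k j, 0 < x k j)
    (hdist : ∀ k l, k ≠ l → ∃ i, ¬ (0 ≤ eval (x k) (p i) ↔ 0 ≤ eval (x l) (p i))) :
    Fintype.card K ≤ (Fintype.card I + Fintype.card J).choose (Fintype.card J) * (a ^ Fintype.card J) := by
  classical
  have ha0 : (a : ℝ) ≠ 0 := by exact_mod_cast (by omega : a ≠ 0)
  obtain ⟨α, hα, hα0⟩ : ∃ α : Option I → ℝ, Function.Injective α ∧ ∀ i, 0 ≤ α i :=
    ⟨fun i => ((Fintype.equivFin (Option I) i : ℕ) : ℝ), fun i j h => by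
      apply (Fintype.equivFin (Option I)).injective
      apply Fin.ext
      exact Nat.cast_injective h, fun i => by positivity⟩
  obtain ⟨β, hβ, hβ0⟩ : ∃ β : Option J → ℝ, Function.Injective β ∧ ∀ i, 0 < β i :=
    ⟨fun i => ((Fintype.equivFin (Option J) i : ℕ) : ℝ) + 1, fun i j h => by
      apply (Fintype.equivFin (Option J)).injective
      apply Fin.ext
      exact Nat.cast_injective (add_right_cancel h), fun i => by positivity⟩
  have hpos : ∀ i j, 0 < α i + β j := fun i j => add_pos_of_nonneg_of_pos (hα0 i) (hβ0 j)
  obtain ⟨c, hc⟩ : ∃ c : Option I → Option J → ℝ, c = fun i j => 1 / (α i + β j) := ⟨_, rfl⟩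
  have hcpos : ∀ i j, 0 < c i j := by
    intro i j; rw [hc]; exact one_div_pos.2 (hpos i j)
  obtain ⟨j0, hj0⟩ := Finite.exists_min fun j : J => c none (some j)
  let F : I → MvPolynomial J ℝ := fun i => C (c (some i) none) + ∑ j, C (c (some i) (some j)) * X j ^ a
  have hFev : ∀ i z, eval z (F i) = c (some i) none + ∑ j, c (some i) (some j) * z j ^ a := by
    intro i z; simp [F]
  have hFpos : ∀ i k, 0 < eval (x k) (F i) := by
    intro i k
    rw [hFev]
    refine add_pos_of_pos_of_nonneg (hcpos _ _) (Finset.sum_nonneg fun j _ => ?_)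
    have := hx k j
    have := hcpos (some i) (some j)
    positivity
  have hFder : ∀ i j z, z j * eval z (pderiv j (F i)) = a * (c (some i) (some j) * z j ^ a) := by
    intro i j z
    have : eval z (pderiv j (F i)) = c (some i) (some j) * (a * z j ^ (a - 1)) := by
      simp only [F, map_sum, map_add, pderiv_C, zero_add]
      rw [Finset.sum_eq_single j]
      · simp [pderiv_C_mul, pderiv_pow]
      · intro l _ hl; simp [pderiv_C_mul, pderiv_pow, pderiv_X_of_ne hl]
      · simp
    rw [this]
    have e3 : z j ^ a = z j * z j ^ (a - 1) := by
      rw [← pow_succ']; congr 1; omega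
    rw [e3]; ring
  clear_value F
  let n2 := Fintype.card J * a + Fintype.card K
  let n1 := Fintype.card I + Fintype.card J
  let g : I ⊕ J → MvPolynomial (I ⊕ J) ℝ := fun κ => Afac c κ * Bfac a c κ
  let W0 : Submodule ℝ (MvPolynomial (I ⊕ J) ℝ) := ⨆ κ, (Vd I J n1 n2).map (LinearMap.mulLeft ℝ (g κ))
  obtain ⟨T, hTc, hT⟩ := special_span a n2 ha (by omega) α β hα hβ hpos c hc W0 (by
    intro κ v hv
    exact Submodule.mem_iSup_of_mem κ ⟨v, hv, rfl⟩)
  let δ : I ⊕ J → MvPolynomial (I ⊕ J) ℝ := Sum.elim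
    (fun i => X (Sum.inl i) * rename Sum.inr (p i) + 1)
    (fun j => C (1 / (a : ℝ)) * (∑ i, X (Sum.inl i) * rename Sum.inr (X j * pderiv j (p i)) - 1))
  have hδ : ∀ κ, δ κ ∈ Vd I J 1 a := by
    rintro (i | j)
    · exact Submodule.add_mem _ (Vd_mul (Vd_inl i) (rename_mem_Vd a _ (hp i)) (by omega) (by omega)) Vd_one
    · refine Vd_mul (n1 := 0) (n2 := 0) (Vd_C _) (Submodule.sub_mem (Vd I J 1 a) (Submodule.sum_mem _ fun i _ => ?_) Vd_one) (by omega) (by omega)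
      exact Vd_mul (Vd_inl i) (rename_pderiv_mem_Vd a _ (hp i) j) (by omega) (by omega)
  obtain ⟨Bad, hBad, hgen⟩ := generic_span n1 n2 1 a g δ hδ T (by
    intro W hW
    refine hT.trans (sup_le_sup_right (iSup_le fun κ => ?_) _)
    rintro _ ⟨v, hv, rfl⟩
    exact hW κ v hv)
  obtain ⟨M, hM⟩ := hBad.bddAbove
  have hev : ∀ᶠ s : ℝ in Filter.atTop, ∀ k i, eval (x k) (p i) < 0 →
      eval (x k) (F i) + s * eval (x k) (p i) < 0 := by
    rw [Filter.eventually_all]; intro k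
    rw [Filter.eventually_all]; intro i
    filter_upwards [Filter.eventually_gt_atTop (eval (x k) (F i) / (- eval (x k) (p i)))] with s hs hneg
    rw [div_lt_iff₀ (by linarith)] at hs
    linarith
  obtain ⟨s, hs1, hs0, hsM⟩ := (hev.and ((Filter.eventually_gt_atTop 0).and (Filter.eventually_gt_atTop M))).exists
  have hsB : s ∉ Bad := fun h => absurd (hM h) (not_le.2 hsM)
  let P : I → MvPolynomial J ℝ := fun i => F i + C s * p i
  have hPev : ∀ i z, eval z (P i) = eval z (F i) + s * eval z (p i) := by intro i z; simp [P]
  have hPder : ∀ i j z, z j * eval z (pderiv j (P i)) =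
      a * (c (some i) (some j) * z j ^ a) + s * (z j * eval z (pderiv j (p i))) := by
    intro i j z
    rw [← hFder]
    simp only [P, map_add, pderiv_C_mul, map_mul, eval_C, smul_eq_mul]
    ring
  clear_value P
  let σ : K → I → ℝ := fun k i => if 0 ≤ eval (x k) (p i) then 1 else -1
  have hσ0 : ∀ k i, σ k i ≠ 0 := by
    intro k i; simp only [σ]; split_ifs <;> norm_num
  have hσP : ∀ k i, 0 < eval (x k) (C (σ k i) * P i) := by
    intro k i
    rw [map_mul, eval_C, hPev]
    simp only [σ]
    split_ifs with h
    · have := hFpos i k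
      have := mul_nonneg hs0.le h
      linarith
    · have := hs1 k i (not_le.1 h)
      linarith
  choose z hz1 hz2 hz3 using fun k => crit_point (fun i => C (σ k i) * P i) a ha (fun j => c none (some j))
    (c none (some j0)) (hcpos _ _) hj0 s hs0 (x k) (hx k) (hσP k)
  simp only [map_mul, eval_C] at hz2
  have hP0 : ∀ k i, eval (z k) (P i) ≠ 0 := fun k i => right_ne_zero_of_mul (hz2 k i).ne'
  have hz3' : ∀ k j, c none (some j) * (a * z k j ^ a) =
      s * (∑ i, z k j * eval (z k) (pderiv j (P i)) / eval (z k) (P i) + 1) := by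
    intro k j
    rw [hz3 k j]
    congr 2
    refine Finset.sum_congr rfl fun i _ => ?_
    have h1 := hP0 k i
    have h2 := hσ0 k i
    simp only [pderiv_C_mul, map_mul, eval_C, smul_eq_mul, smul_eval]
    field_simp
  let lam : K → I → ℝ := fun k i => - s / eval (z k) (P i)
  let y : K → I ⊕ J → ℝ := fun k => Sum.elim (lam k) (z k)
  have hyr : ∀ k (q : MvPolynomial J ℝ), eval (y k) (rename Sum.inr q) = eval (z k) q := by
    intro k q
    rw [eval_rename]; simp only [y, Sum.elim_comp_inr]
  have hvan : ∀ k κ, eval (y k) (g κ + s • δ κ) = 0 := by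
    rintro k (i | j)
    · have e1 : eval (y k) (Bfac a c (Sum.inl i)) = eval (z k) (F i) := by
        simp [Bfac, Fintype.sum_option, Uel, hFev, y, smul_eval]
      simp only [g, δ, Afac, Sum.elim_inl, map_add, map_mul, smul_eval, e1, hyr, eval_X, map_one]
      have h1 := hP0 k i
      have h2 := hPev i (z k)
      have h3 : lam k i * eval (z k) (P i) = - s := by simp only [lam]; field_simp
      rw [h2] at h3
      simp only [y, Sum.elim_inl]
      linarith
    · have e1 : eval (y k) (Afac c (Sum.inr j)) = c none (some j) + ∑ i, c (some i) (some j) * lam k i := by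
        simp [Afac, Fintype.sum_option, Lel, y, smul_eval]
      have e2 : eval (y k) (Bfac a c (Sum.inr j)) = z k j ^ a := by simp [Bfac, y]
      have e3 : eval (y k) (δ (Sum.inr j)) = 1 / a * (∑ i, lam k i * (z k j * eval (z k) (pderiv j (p i))) - 1) := by
        simp only [δ, Sum.elim_inr, map_mul, eval_C, map_sub, map_sum, map_one, eval_X]
        simp only [← map_mul, hyr]
        simp [y, eval_rename]
      rw [map_add, smul_eval, e3]
      simp only [g]
      rw [map_mul, e1, e2]
      have h4 := hz3' k j
      have h5 : s * ∑ i, z k j * eval (z k) (pderiv j (P i)) / eval (z k) (P i) =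
          - (a * z k j ^ a * ∑ i, c (some i) (some j) * lam k i
            + s * ∑ i, lam k i * (z k j * eval (z k) (pderiv j (p i)))) := by
        rw [Finset.mul_sum, Finset.mul_sum, Finset.mul_sum, ← Finset.sum_add_distrib, ← Finset.sum_neg_distrib]
        refine Finset.sum_congr rfl fun i _ => ?_
        rw [hPder]
        simp only [lam]
        have h1 := hP0 k i
        field_simp
        ring
      rw [mul_add, h5] at h4
      generalize ∑ i, lam k i * (z k j * eval (z k) (pderiv j (p i))) = S1 at h4 ⊢
      generalize ∑ i, c (some i) (some j) * lam k i = S2 at h4 ⊢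
      field_simp
      linarith
  have hyz : ∀ k j, y k (Sum.inr j) = z k j := fun k j => rfl
  clear_value y lam g δ
  have hfin := eval_count (n1 + 1) (n2 + a) y (by
    intro k l hkl
    by_contra hcon
    push Not at hcon
    simp only [hyz] at hcon
    have hzz : z k = z l := _root_.funext hcon
    obtain ⟨i, hi⟩ := hdist k l hkl
    have h1 := hz2 k i
    have h2 := hz2 l i
    rw [hzz] at h1
    simp only [σ] at h1 h2
    split_ifs at h1 h2 <;> first | tauto | linarith) T (by omega) (by
    intro W hW
    refine hgen s hs0 hsB W fun κ v => hW _ fun k => ?_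
    rw [map_mul, hvan, zero_mul])
  exact hfin.trans hTc

lemma count_all [Nonempty J] {K : Type} [Fintype K] (a : ℕ) (ha : 1 ≤ a)
    (p : I → MvPolynomial J ℝ) (hp : ∀ i, (p i).totalDegree ≤ a) (x : K → J → ℝ)
    (hdist : ∀ k l, k ≠ l → ∃ i, ¬ (0 ≤ eval (x k) (p i) ↔ 0 ≤ eval (x l) (p i))) :
    Fintype.card K ≤ (Fintype.card I + Fintype.card J).choose (Fintype.card J) * (a ^ Fintype.card J) := by
  classical
  let M : ℝ := ∑ k, ∑ j, |x k j| + 1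
  have hM : ∀ k j, 0 < x k j + M := by
    intro k j
    have h1 : |x k j| ≤ ∑ j, |x k j| := Finset.single_le_sum (f := fun j => |x k j|) (fun _ _ => abs_nonneg _) (Finset.mem_univ j)
    have h2 : ∑ j, |x k j| ≤ ∑ k, ∑ j, |x k j| :=
      Finset.single_le_sum (f := fun k => ∑ j, |x k j|) (fun _ _ => Finset.sum_nonneg fun _ _ => abs_nonneg _) (Finset.mem_univ k)
    have h3 := neg_abs_le (x k j)
    simp only [M]; linarith
  let f : J → MvPolynomial J ℝ := fun j => X j - C M
  have he : ∀ k i, eval (fun j => x k j + M) (bind₁ f (p i)) = eval (x k) (p i) := by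
    intro k i
    have : eval (fun j => x k j + M) (bind₁ f (p i)) = eval (fun j => eval (fun j => x k j + M) (f j)) (p i) := by
      rw [← coe_aeval_eq_eval, ← coe_aeval_eq_eval]
      exact aeval_bind₁ _ _ _
    rw [this]; simp [f]
  refine count_pos a ha (fun i => bind₁ f (p i)) (fun i => (totalDegree_bind_le f (fun j => ?_) (p i)).trans (hp i))
    (fun k j => x k j + M) hM ?_
  · refine (totalDegree_sub _ _).trans ?_
    simp
  · intro k l hkl
    obtain ⟨i, hi⟩ := hdist k l hkl
    exact ⟨i, by rw [he, he]; exact hi⟩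

end Warren

lemma numeric_bound (d m a : ℕ) (hd : 1 ≤ d) (hm : d ≤ m) :
    (((m + d).choose d * a ^ d : ℕ) : ℝ) ≤ (2 * Real.exp 1 * m * a / d) ^ d := by
  have hd0 : (0 : ℝ) < d := by exact_mod_cast hd
  have h1 : ((m + d).choose d : ℝ) ≤ ((m + d : ℕ) : ℝ) ^ d / (d.factorial : ℝ) := Nat.choose_le_pow_div d (m + d)
  have h2 : ((m + d : ℕ) : ℝ) ^ d ≤ (2 * m) ^ d := by
    apply pow_le_pow_left₀ (by positivity)
    push_cast
    have : (d : ℝ) ≤ m := by exact_mod_cast hm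
    linarith
  have h3 : (d : ℝ) ^ d / (d.factorial : ℝ) ≤ Real.exp 1 ^ d := by
    have := Real.pow_div_factorial_le_exp (d : ℝ) hd0.le d
    rwa [← Real.exp_one_pow] at this
  have h4 : 1 / (d.factorial : ℝ) ≤ (Real.exp 1 / d) ^ d := by
    rw [div_pow, le_div_iff₀ (by positivity)]
    calc 1 / (d.factorial : ℝ) * (d : ℝ) ^ d = (d : ℝ) ^ d / (d.factorial : ℝ) := by ring
      _ ≤ _ := h3
  push_cast
  calc ((m + d).choose d : ℝ) * (a : ℝ) ^ d ≤ ((2 * m) ^ d / (d.factorial : ℝ)) * (a : ℝ) ^ d := by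
        gcongr
        exact h1.trans (by gcongr)
    _ = (2 * m) ^ d * (1 / (d.factorial : ℝ)) * (a : ℝ) ^ d := by ring
    _ ≤ (2 * m) ^ d * (Real.exp 1 / d) ^ d * (a : ℝ) ^ d := by gcongr
    _ = _ := by rw [← mul_pow, ← mul_pow]; congr 1; ring

lemma sgn01_div (x y : ℝ) (hy : 0 < y) : sgn01 (x / y) = sgn01 x := by
  unfold sgn01
  simp only [le_div_iff₀ hy, zero_mul]

/-- if for every instance `I` the function `μ ↦ h(I, μ)` is piecewise
constant over the sign regions of `Γ` rational functions (quotients of polynomials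
of degree at most `a` over positive-on-`P` denominators), then for any `t ≥ d`
instances `I₁,…,I_t` and thresholds `s₁,…,s_t`, the number of sign patterns
`(sgn(h(I₁,μ) - s₁), …, sgn(h(I_t,μ) - s_t))` over `μ ∈ P` is at most
`2(2eΓta/d)^d`. -/
theorem stmt16 (d Γ a : ℕ) (hd : 1 ≤ d) (hΓ : 1 ≤ Γ) (ha : 1 ≤ a)
    (P : Set (Fin d → ℝ)) (𝓘 : Type*) (h : 𝓘 → (Fin d → ℝ) → ℤ)
    (hstruct : ∀ I : 𝓘, ∃ p q : Fin Γ → MvPolynomial (Fin d) ℝ,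
      (∀ i, (p i).totalDegree ≤ a) ∧
      (∀ i, ∀ μ ∈ P, 0 < MvPolynomial.eval μ (q i)) ∧
      (∀ μ ∈ P, ∀ μ' ∈ P,
        (∀ i, sgn01 (MvPolynomial.eval μ (p i) / MvPolynomial.eval μ (q i)) =
              sgn01 (MvPolynomial.eval μ' (p i) / MvPolynomial.eval μ' (q i))) →
        h I μ = h I μ')) :
    ∀ t : ℕ, d ≤ t → ∀ (Is : Fin t → 𝓘) (s : Fin t → ℝ),
      (({σ : Fin t → ℕ | ∃ μ ∈ P, σ = fun j => sgn01 ((h (Is j) μ : ℝ) - s j)}.ncard : ℝ)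
        ≤ 2 * (2 * Real.exp 1 * Γ * t * a / d) ^ d) := by
  intro t ht Is s
  set S : Set (Fin t → ℕ) := {σ : Fin t → ℕ | ∃ μ ∈ P, σ = fun j => sgn01 ((h (Is j) μ : ℝ) - s j)} with hS
  have hnn : (0 : ℝ) ≤ (2 * Real.exp 1 * Γ * t * a / d) ^ d := by positivity
  by_cases hfin : S.Finite
  swap
  · rw [Set.Infinite.ncard hfin]; push_cast; linarith
  have : Fintype S := hfin.fintype
  have : Nonempty (Fin d) := ⟨⟨0, by omega⟩⟩
  choose p q hp hq hpq using hstruct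
  choose x hxP hx using fun σ : S => σ.2
  have key := count_all (I := Fin t × Fin Γ) (J := Fin d) (K := S) a ha
    (fun i => p (Is i.1) i.2) (fun i => hp _ _) x (by
      intro k l hkl
      by_contra hcon
      push Not at hcon
      apply hkl
      apply Subtype.ext
      rw [hx k, hx l]
      funext j
      rw [hpq (Is j) (x k) (hxP k) (x l) (hxP l) (fun i => by
        rw [sgn01_div _ _ (hq _ _ _ (hxP k)), sgn01_div _ _ (hq _ _ _ (hxP l))]
        unfold sgn01
        simp only [hcon (j, i)])])
  rw [Fintype.card_prod, Fintype.card_fin, Fintype.card_fin, Fintype.card_fin] at key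
  have h1 : S.ncard = Fintype.card S := by
    rw [← Nat.card_coe_set_eq, Nat.card_eq_fintype_card]
  have h2 : (Fintype.card S : ℝ) ≤ (((t * Γ + d).choose d * a ^ d : ℕ) : ℝ) := by exact_mod_cast key
  have h3 := numeric_bound d (t * Γ) a hd (ht.trans (Nat.le_mul_of_pos_right t hΓ))
  have h4 : (2 * Real.exp 1 * ((t * Γ : ℕ) : ℝ) * a / d) = (2 * Real.exp 1 * Γ * t * a / d) := by
    push_cast; ring
  rw [h4] at h3
  rw [h1]
  linarith
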